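/- Let X be a real Banach space, a < b, and let f : (a,b) → X be Lipschitz. Then the optimal Lipschitz constant of f on (a,b), namely inf{ L > 0 : ‖f(α) − f(β)‖ ≤ L|α−β| for all α, β ∈ (a,b) }, is at most sup_{α ∈ (a,b)} limsup_{s → 0⁺} (1/s) ‖f(α−s) − f(α)‖, where the limsup is over s → 0⁺ with α−s ∈ (a,b). -/

import Mathlib

open Set Filter Topology in
/-- If all backward difference quotients of a continuous `f` are eventually bounded by every
`r > M`, then `M` is a Lipschitz constant for `f` on the interval. -/
theorem norm_sub_le_of_eventually_backward_slope_lt {X : Type*} [NormedAddCommGroup X]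
    {f : ℝ → X} {c d M : ℝ} (hcd : c ≤ d) (hf : ContinuousOn f (Icc c d))
    (hM : ∀ x ∈ Ioc c d, ∀ r, M < r → ∀ᶠ s in 𝓝[>] (0 : ℝ), ‖f (x - s) - f x‖ / s < r) :
    ‖f c - f d‖ ≤ M * (d - c) := by
  have hcont : ContinuousOn (fun t => ‖f (-t) - f d‖) (Icc (-d) (-c)) := by
    refine ((hf.comp continuous_neg.continuousOn ?_).sub continuousOn_const).norm
    intro t ht
    exact ⟨by linarith [ht.2], by linarith [ht.1]⟩
  have key := image_le_of_liminf_slope_right_le_deriv_boundary hcont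
    (B := fun t => M * (t - -d)) (B' := fun _ => M) (by simp) (by fun_prop)
    (fun x _ => by
      simpa using (((hasDerivWithinAt_id x (Ici x)).sub_const (-d)).const_mul M))
    (fun x hx r hr => by
      apply Eventually.frequently
      have htend : Tendsto (fun z => z - x) (𝓝[>] x) (𝓝[>] (0 : ℝ)) := by
        refine tendsto_nhdsWithin_iff.2 ⟨?_, ?_⟩
        · have : Tendsto (fun z => z - x) (𝓝 x) (𝓝 (x - x)) := by
            exact tendsto_id.sub_const x
          rw [sub_self] at this
          exact this.mono_left nhdsWithin_le_nhds
        · filter_upwards [self_mem_nhdsWithin] with z hz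
          exact sub_pos.2 (mem_Ioi.1 hz)
      have hx' : -x ∈ Ioc c d := ⟨by linarith [hx.2], by linarith [hx.1]⟩
      filter_upwards [htend.eventually (hM (-x) hx' r hr), self_mem_nhdsWithin] with z hz hxz
      have hpos : 0 < z - x := sub_pos.2 hxz
      rw [slope_def_field]
      refine lt_of_le_of_lt ?_ hz
      rw [show -x - (z - x) = -z by ring]
      gcongr
      calc ‖f (-z) - f d‖ - ‖f (-x) - f d‖ ≤ ‖(f (-z) - f d) - (f (-x) - f d)‖ :=
            norm_sub_norm_le _ _
        _ = ‖f (-z) - f (-x)‖ := by rw [sub_sub_sub_cancel_right])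
  have := key (x := -c) ⟨neg_le_neg hcd, le_rfl⟩
  simp only [neg_neg] at this
  linarith

open Set Filter Topology in
theorem nhdsWithin_pos_and_sub_mem_Ioo {a b x : ℝ} (hx : x ∈ Ioo a b) :
    𝓝[{s : ℝ | 0 < s ∧ x - s ∈ Ioo a b}] 0 = 𝓝[>] 0 := by
  have h : {s : ℝ | 0 < s ∧ x - s ∈ Ioo a b} = Ioo 0 (x - a) := by
    ext s
    simp only [mem_ofPred_eq, mem_Ioo] at hx ⊢
    constructor
    · rintro ⟨h0, h1, h2⟩
      exact ⟨h0, by linarith⟩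
    · rintro ⟨h0, h1⟩
      exact ⟨h0, by linarith, by linarith⟩
  rw [h, nhdsWithin_Ioo_eq_nhdsGT (sub_pos.2 hx.1)]

open Set Filter Topology in
theorem LipschitzOnWith.eventually_backward_slope_le {X : Type*} [NormedAddCommGroup X]
    {f : ℝ → X} {a b x : ℝ} {K : NNReal} (hf : LipschitzOnWith K f (Ioo a b))
    (hx : x ∈ Ioo a b) : ∀ᶠ s in 𝓝[>] (0 : ℝ), ‖f (x - s) - f x‖ / s ≤ K := by
  rw [← nhdsWithin_pos_and_sub_mem_Ioo hx]
  filter_upwards [self_mem_nhdsWithin] with s hs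
  rw [div_le_iff₀ hs.1]
  simpa [abs_of_pos hs.1] using hf.norm_sub_le hs.2 hx

open Set Filter Topology in
theorem eventually_backward_slope_nonneg {X : Type*} [NormedAddCommGroup X] (f : ℝ → X) (x : ℝ) :
    ∀ᶠ s in 𝓝[>] (0 : ℝ), 0 ≤ ‖f (x - s) - f x‖ / s := by
  filter_upwards [self_mem_nhdsWithin] with s hs
  exact div_nonneg (norm_nonneg _) (le_of_lt hs)

/-- For a Lipschitz `f : (a,b) → X`, the optimal Lipschitz constant is
at most the supremum over `α ∈ (a,b)` of the limsup of backward difference quotients. -/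
theorem optimal_lipschitz_le_sup_limsup {X : Type*} [NormedAddCommGroup X]
    [NormedSpace ℝ X] (a b : ℝ) (hab : a < b) (f : ℝ → X) (K : NNReal)
    (hf : LipschitzOnWith K f (Set.Ioo a b)) :
    sInf {L : ℝ | 0 < L ∧ ∀ α ∈ Set.Ioo a b, ∀ β ∈ Set.Ioo a b,
        ‖f α - f β‖ ≤ L * |α - β|}
      ≤ ⨆ α ∈ Set.Ioo a b,
          Filter.limsup (fun s : ℝ => ‖f (α - s) - f α‖ / s)
            (nhdsWithin 0 {s : ℝ | 0 < s ∧ α - s ∈ Set.Ioo a b}) := by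
  set ℓ : ℝ → ℝ := fun α => Filter.limsup (fun s : ℝ => ‖f (α - s) - f α‖ / s)
    (nhdsWithin 0 {s : ℝ | 0 < s ∧ α - s ∈ Set.Ioo a b}) with hℓ
  have hbdd : ∀ α ∈ Set.Ioo a b, Filter.IsBoundedUnder (· ≤ ·)
      (nhdsWithin 0 (Set.Ioi 0)) (fun s : ℝ => ‖f (α - s) - f α‖ / s) := fun α hα =>
    Filter.isBoundedUnder_of_eventually_le (hf.eventually_backward_slope_le hα)
  have hcobdd : ∀ α, Filter.IsCoboundedUnder (· ≤ ·)
      (nhdsWithin 0 (Set.Ioi 0)) (fun s : ℝ => ‖f (α - s) - f α‖ / s) := fun α =>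
    (Filter.isBoundedUnder_of_eventually_ge
      (eventually_backward_slope_nonneg f α)).isCoboundedUnder_le
  have hnonneg : ∀ α ∈ Set.Ioo a b, 0 ≤ ℓ α := fun α hα => by
    simp only [hℓ, nhdsWithin_pos_and_sub_mem_Ioo hα]
    exact Filter.le_limsup_of_frequently_le
      (eventually_backward_slope_nonneg f α).frequently (hbdd α hα)
  have hle : ∀ α ∈ Set.Ioo a b, ℓ α ≤ K := fun α hα => by
    simp only [hℓ, nhdsWithin_pos_and_sub_mem_Ioo hα]
    exact Filter.limsup_le_of_le (hcobdd α) (hf.eventually_backward_slope_le hα)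
  have hsup : ∀ α ∈ Set.Ioo a b, ℓ α ≤ ⨆ α ∈ Set.Ioo a b, ℓ α := fun α hα => by
    have hB : BddAbove (Set.range fun α => ⨆ _ : α ∈ Set.Ioo a b, ℓ α) :=
      ⟨K, by rintro _ ⟨β, rfl⟩; exact Real.iSup_le (hle β) K.2⟩
    refine le_trans (le_of_eq ?_) (le_ciSup hB α)
    rw [ciSup_pos hα]
  set M := ⨆ α ∈ Set.Ioo a b, ℓ α
  obtain ⟨m, hm⟩ := Set.nonempty_Ioo.2 hab
  have hM : 0 ≤ M := (hnonneg m hm).trans (hsup m hm)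
  have main : ∀ c ∈ Set.Ioo a b, ∀ d ∈ Set.Ioo a b, c ≤ d → ‖f c - f d‖ ≤ M * (d - c) := by
    intro c hc d hd hcd
    refine norm_sub_le_of_eventually_backward_slope_lt hcd
      (hf.continuousOn.mono (Set.Icc_subset_Ioo hc.1 hd.2)) fun x hx r hr => ?_
    have hx' : x ∈ Set.Ioo a b := ⟨hc.1.trans hx.1, hx.2.trans_lt hd.2⟩
    have hlt := (hsup x hx').trans_lt hr
    simp only [hℓ, nhdsWithin_pos_and_sub_mem_Ioo hx'] at hlt
    exact Filter.eventually_lt_of_limsup_lt hlt (hbdd x hx')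
  refine le_of_forall_pos_le_add fun ε hε => csInf_le ⟨0, fun L hL => hL.1.le⟩
    ⟨by linarith, fun α hα β hβ => ?_⟩
  have hM_abs : ‖f α - f β‖ ≤ M * |α - β| := by
    rcases le_total α β with h | h
    · rw [abs_sub_comm, abs_of_nonneg (sub_nonneg.2 h)]
      exact main α hα β hβ h
    · rw [norm_sub_rev, abs_of_nonneg (sub_nonneg.2 h)]
      exact main β hβ α hα h
  exact hM_abs.trans (by gcongr; linarith)
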